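/- For every integer n ≥ 1, the following identity holds in ℤ[p,q,t,u,v,w,y]: Σ_{σ∈S_n} p^{nest σ} q^{cros σ} t^{drop σ} u^{cda σ} v^{cdd σ} w^{cvalley σ} y^{fix σ} = Σ_{γ∈M_n} Π_{s step of γ} wt(s), where for a step s of height h (ordinate of its starting point): wt(s) = tw·[h+1]_{p,q} if s is an up step, wt(s) = y·p^h + (qu+tv)·[h]_{p,q} if s is a level step, and wt(s) = [h]_{p,q} if s is a down step; here [m]_{p,q} = p^{m−1} + p^{m−2}q + ⋯ + q^{m−1} (with [0]_{p,q}=0) and M_n is the set of Motzkin paths of length n. -/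

import Mathlib

open scoped Classical
open Finset

noncomputable section

namespace SZpaper

/-- `σ` as a 1-indexed function on `[1,n]`, extended by `0` elsewhere
(boundary convention `σ(0)=σ(n+1)=0`). -/
def pext (n : ℕ) (σ : Equiv.Perm (Fin n)) (i : ℕ) : ℕ :=
  if h : 1 ≤ i ∧ i ≤ n then ((σ ⟨i - 1, by omega⟩ : Fin n) : ℕ) + 1 else 0

/-- `σ` extended with the Brändén boundary convention `σ(0)=σ(n+1)=n+1`. -/
def pextB (n : ℕ) (σ : Equiv.Perm (Fin n)) (i : ℕ) : ℕ :=
  if h : 1 ≤ i ∧ i ≤ n then ((σ ⟨i - 1, by omega⟩ : Fin n) : ℕ) + 1 else n + 1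

/-- `σ` extended with the boundary convention `σ(0)=0`, `σ(n+1)=n+1`. -/
def pextC (n : ℕ) (σ : Equiv.Perm (Fin n)) (i : ℕ) : ℕ :=
  if h : 1 ≤ i ∧ i ≤ n then ((σ ⟨i - 1, by omega⟩ : Fin n) : ℕ) + 1
  else if i = 0 then 0 else n + 1

/-- The set of pairs `(i,j)` with `i, j ∈ [1,n]`. -/
def pairs (n : ℕ) : Finset (ℕ × ℕ) := Finset.Icc 1 n ×ˢ Finset.Icc 1 n

/-- `des σ = #{i ∈ [n−1] : σ(i) > σ(i+1)}`. -/
def desStat (n : ℕ) (σ : Equiv.Perm (Fin n)) : ℕ :=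
  ((Finset.Icc 1 (n - 1)).filter fun i => pext n σ (i + 1) < pext n σ i).card

/-- `les σ = #{(i,j) : 2 ≤ i < j ≤ n, σ(i−1) > σ(j) > σ(i)}`. -/
def lesStat (n : ℕ) (σ : Equiv.Perm (Fin n)) : ℕ :=
  ((pairs n).filter fun x => 2 ≤ x.1 ∧ x.1 < x.2 ∧
    pext n σ x.1 < pext n σ x.2 ∧ pext n σ x.2 < pext n σ (x.1 - 1)).card

/-- `less σ = #{(i,j) : 2 ≤ i < j ≤ n, σ(i−1) < σ(j) < σ(i)}`. -/
def lessStat (n : ℕ) (σ : Equiv.Perm (Fin n)) : ℕ :=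
  ((pairs n).filter fun x => 2 ≤ x.1 ∧ x.1 < x.2 ∧
    pext n σ (x.1 - 1) < pext n σ x.2 ∧ pext n σ x.2 < pext n σ x.1).card

/-- `res σ = #{(i,j) : 1 ≤ i < j ≤ n−1, σ(j+1) > σ(i) > σ(j)}`. -/
def resStat (n : ℕ) (σ : Equiv.Perm (Fin n)) : ℕ :=
  ((pairs n).filter fun x => x.1 < x.2 ∧ x.2 ≤ n - 1 ∧
    pext n σ x.2 < pext n σ x.1 ∧ pext n σ x.1 < pext n σ (x.2 + 1)).card

/-- `ress σ = #{(i,j) : 1 ≤ i < j ≤ n−1, σ(j+1) < σ(i) < σ(j)}`. -/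
def ressStat (n : ℕ) (σ : Equiv.Perm (Fin n)) : ℕ :=
  ((pairs n).filter fun x => x.1 < x.2 ∧ x.2 ≤ n - 1 ∧
    pext n σ (x.2 + 1) < pext n σ x.1 ∧ pext n σ x.1 < pext n σ x.2).card

/-! Linear statistics with the boundary convention `σ(0)=σ(n+1)=0` (starred). -/

def peakStar (n : ℕ) (σ : Equiv.Perm (Fin n)) : ℕ :=
  ((Finset.Icc 1 n).filter fun i =>
    pext n σ (i - 1) < pext n σ i ∧ pext n σ (i + 1) < pext n σ i).card

def valleyStar (n : ℕ) (σ : Equiv.Perm (Fin n)) : ℕ :=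
  ((Finset.Icc 1 n).filter fun i =>
    pext n σ i < pext n σ (i - 1) ∧ pext n σ i < pext n σ (i + 1)).card

def daStar (n : ℕ) (σ : Equiv.Perm (Fin n)) : ℕ :=
  ((Finset.Icc 1 n).filter fun i =>
    pext n σ (i - 1) < pext n σ i ∧ pext n σ i < pext n σ (i + 1)).card

def ddStar (n : ℕ) (σ : Equiv.Perm (Fin n)) : ℕ :=
  ((Finset.Icc 1 n).filter fun i =>
    pext n σ (i + 1) < pext n σ i ∧ pext n σ i < pext n σ (i - 1)).card

/-! Linear statistics with the Brändén boundary convention `σ(0)=σ(n+1)=n+1`. -/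

def peakB (n : ℕ) (σ : Equiv.Perm (Fin n)) : ℕ :=
  ((Finset.Icc 1 n).filter fun i =>
    pextB n σ (i - 1) < pextB n σ i ∧ pextB n σ (i + 1) < pextB n σ i).card

def valleyB (n : ℕ) (σ : Equiv.Perm (Fin n)) : ℕ :=
  ((Finset.Icc 1 n).filter fun i =>
    pextB n σ i < pextB n σ (i - 1) ∧ pextB n σ i < pextB n σ (i + 1)).card

def daB (n : ℕ) (σ : Equiv.Perm (Fin n)) : ℕ :=
  ((Finset.Icc 1 n).filter fun i =>
    pextB n σ (i - 1) < pextB n σ i ∧ pextB n σ i < pextB n σ (i + 1)).card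

def ddB (n : ℕ) (σ : Equiv.Perm (Fin n)) : ℕ :=
  ((Finset.Icc 1 n).filter fun i =>
    pextB n σ (i + 1) < pextB n σ i ∧ pextB n σ i < pextB n σ (i - 1)).card

/-! Linear statistics with the boundary convention `σ(0)=0`, `σ(n+1)=n+1`. -/

def valleyC (n : ℕ) (σ : Equiv.Perm (Fin n)) : ℕ :=
  ((Finset.Icc 1 n).filter fun i =>
    pextC n σ i < pextC n σ (i - 1) ∧ pextC n σ i < pextC n σ (i + 1)).card

def daC (n : ℕ) (σ : Equiv.Perm (Fin n)) : ℕ :=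
  ((Finset.Icc 1 n).filter fun i =>
    pextC n σ (i - 1) < pextC n σ i ∧ pextC n σ i < pextC n σ (i + 1)).card

def ddC (n : ℕ) (σ : Equiv.Perm (Fin n)) : ℕ :=
  ((Finset.Icc 1 n).filter fun i =>
    pextC n σ (i + 1) < pextC n σ i ∧ pextC n σ i < pextC n σ (i - 1)).card

/-- `fmax σ`: the number of double ascents (convention `σ(0)=0`, `σ(n+1)=n+1`)
which are left-to-right maxima. -/
def fmaxStat (n : ℕ) (σ : Equiv.Perm (Fin n)) : ℕ :=
  ((Finset.Icc 1 n).filter fun i =>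
    pextC n σ (i - 1) < pextC n σ i ∧ pextC n σ i < pextC n σ (i + 1) ∧
    ∀ j ∈ Finset.Ico 1 i, pext n σ j < pext n σ i).card

/-! Cyclic statistics. -/

def excStat (n : ℕ) (σ : Equiv.Perm (Fin n)) : ℕ :=
  ((Finset.Icc 1 n).filter fun i => i < pext n σ i).card

def wexStat (n : ℕ) (σ : Equiv.Perm (Fin n)) : ℕ :=
  ((Finset.Icc 1 n).filter fun i => i ≤ pext n σ i).card

def dropStat (n : ℕ) (σ : Equiv.Perm (Fin n)) : ℕ :=
  ((Finset.Icc 1 n).filter fun i => pext n σ i < i).card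

def fixStat (n : ℕ) (σ : Equiv.Perm (Fin n)) : ℕ :=
  ((Finset.Icc 1 n).filter fun i => pext n σ i = i).card

/-- cyclic valleys: `x` with `σ⁻¹(x) > x < σ(x)`. -/
def cvalleyStat (n : ℕ) (σ : Equiv.Perm (Fin n)) : ℕ :=
  ((Finset.Icc 1 n).filter fun x => x < pext n σ⁻¹ x ∧ x < pext n σ x).card

/-- double excedances: `x` with `σ⁻¹(x) < x < σ(x)`. -/
def cdaStat (n : ℕ) (σ : Equiv.Perm (Fin n)) : ℕ :=
  ((Finset.Icc 1 n).filter fun x => pext n σ⁻¹ x < x ∧ x < pext n σ x).card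

/-- double drops: `x` with `σ⁻¹(x) > x > σ(x)`. -/
def cddStat (n : ℕ) (σ : Equiv.Perm (Fin n)) : ℕ :=
  ((Finset.Icc 1 n).filter fun x => x < pext n σ⁻¹ x ∧ pext n σ x < x).card

/-- crossings. -/
def crosStat (n : ℕ) (σ : Equiv.Perm (Fin n)) : ℕ :=
  ((pairs n).filter fun x =>
    (x.1 < x.2 ∧ x.2 ≤ pext n σ x.1 ∧ pext n σ x.1 < pext n σ x.2) ∨
    (x.2 < x.1 ∧ pext n σ x.1 < x.2 ∧ pext n σ x.2 < pext n σ x.1)).card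

/-- nestings. -/
def nestStat (n : ℕ) (σ : Equiv.Perm (Fin n)) : ℕ :=
  ((pairs n).filter fun x =>
    (x.1 < x.2 ∧ x.2 ≤ pext n σ x.2 ∧ pext n σ x.2 < pext n σ x.1) ∨
    (x.2 < x.1 ∧ pext n σ x.2 < x.2 ∧ pext n σ x.1 < pext n σ x.2)).card

/-- number of cycles of `σ` (fixed points count as cycles). -/
def cycStat (n : ℕ) (σ : Equiv.Perm (Fin n)) : ℕ :=
  Multiset.card σ.cycleType + (Finset.univ.filter fun x => σ x = x).card

/-! Star statistics: `σ*(i) = σ(i) − 1`, a bijection `[n] → {0,…,n−1}`;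
we extend `σ*` by `0` outside `[1,n]`. -/

def starf (n : ℕ) (σ : Equiv.Perm (Fin n)) (i : ℕ) : ℕ :=
  if 1 ≤ i ∧ i ≤ n then pext n σ i - 1 else 0

/-- `(σ*)⁻¹(i) = σ⁻¹(i+1)`, defined for `0 ≤ i ≤ n−1`. -/
def invstarf (n : ℕ) (σ : Equiv.Perm (Fin n)) (i : ℕ) : ℕ :=
  pext n σ⁻¹ (i + 1)

def dropStarStat (n : ℕ) (σ : Equiv.Perm (Fin n)) : ℕ :=
  ((Finset.Icc 1 n).filter fun i => starf n σ i < i).card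

def fixStarStat (n : ℕ) (σ : Equiv.Perm (Fin n)) : ℕ :=
  ((Finset.Icc 1 n).filter fun i => starf n σ i = i).card

def wexStarStat (n : ℕ) (σ : Equiv.Perm (Fin n)) : ℕ :=
  ((Finset.Icc 1 n).filter fun i => i ≤ starf n σ i).card

def cdaStarStat (n : ℕ) (σ : Equiv.Perm (Fin n)) : ℕ :=
  ((Finset.Icc 1 n).filter fun i => invstarf n σ i < i ∧ i < starf n σ i).card

def cddStarStat (n : ℕ) (σ : Equiv.Perm (Fin n)) : ℕ :=
  ((Finset.Icc 1 n).filter fun i => i < invstarf n σ i ∧ starf n σ i < i).card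

def cvalleyStarStat (n : ℕ) (σ : Equiv.Perm (Fin n)) : ℕ :=
  ((Finset.Icc 1 n).filter fun i => i < invstarf n σ i ∧ i < starf n σ i).card

def crosStarStat (n : ℕ) (σ : Equiv.Perm (Fin n)) : ℕ :=
  ((pairs n).filter fun x =>
    (x.1 < x.2 ∧ x.2 ≤ starf n σ x.1 ∧ starf n σ x.1 < starf n σ x.2) ∨
    (x.2 < x.1 ∧ starf n σ x.1 < x.2 ∧ starf n σ x.2 < starf n σ x.1)).card

def nestStarStat (n : ℕ) (σ : Equiv.Perm (Fin n)) : ℕ :=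
  ((pairs n).filter fun x =>
    (x.1 < x.2 ∧ x.2 ≤ starf n σ x.2 ∧ starf n σ x.2 < starf n σ x.1) ∨
    (x.2 < x.1 ∧ starf n σ x.2 < x.2 ∧ starf n σ x.1 < starf n σ x.2)).card

/-- `cyc* σ`: the number of cycles of the functional digraph of `σ*` on `[n]`,
counted as the number of `i ∈ [1,n]` that lie on a cycle of `σ*` and are
minimal in their cycle. (The component of `σ*` that is a path from `n` to `0`
contributes no such `i`.) -/
def cycStarStat (n : ℕ) (σ : Equiv.Perm (Fin n)) : ℕ :=
  ((Finset.Icc 1 n).filter fun i =>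
    (∃ m ∈ Finset.Icc 1 n, (starf n σ)^[m] i = i) ∧
    ∀ m ∈ Finset.range (n + 1), i ≤ (starf n σ)^[m] i).card

/-! Motzkin paths, encoded as step sequences `γ : Fin m → Fin 3`
(`0` = up step `(1,1)`, `1` = level step `(1,0)`, `2` = down step `(1,−1)`). -/

/-- The height (ordinate) of the path after `i` steps. -/
def hgt (m : ℕ) (γ : Fin m → Fin 3) (i : ℕ) : ℤ :=
  ∑ j ∈ Finset.range i, if hj : j < m then 1 - ((γ ⟨j, hj⟩ : ℕ) : ℤ) else 0

/-- A step sequence is a Motzkin path if it never goes below the x-axis and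
ends at height `0`. -/
def IsMotzkin (m : ℕ) (γ : Fin m → Fin 3) : Prop :=
  (∀ i ≤ m, 0 ≤ hgt m γ i) ∧ hgt m γ m = 0

/-- The (finite) set of Motzkin paths of length `m`. -/
def motzkin (m : ℕ) : Finset (Fin m → Fin 3) :=
  Finset.univ.filter fun γ => IsMotzkin m γ

/-- number of up (North-East) steps. -/
def neCount (m : ℕ) (γ : Fin m → Fin 3) : ℕ :=
  (Finset.univ.filter fun i => γ i = 0).card

/-- number of level (East) steps. -/
def eCount (m : ℕ) (γ : Fin m → Fin 3) : ℕ :=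
  (Finset.univ.filter fun i => γ i = 1).card

/-- the `(p,q)`-integer `[m]_{p,q} = p^{m−1} + p^{m−2}q + ⋯ + q^{m−1}`. -/
def pqInt {R : Type*} [CommRing R] (p q : R) (m : ℕ) : R :=
  ∑ j ∈ Finset.range m, p ^ (m - 1 - j) * q ^ j

section PartialPermutations

variable {R : Type*} [CommRing R]

lemma pqInt_succ (p q : R) (m : ℕ) : pqInt p q (m + 1) = p ^ m + q * pqInt p q m := by
  unfold pqInt
  rw [sum_range_succ', mul_sum, add_comm]
  congr 1
  · simp
  · refine sum_congr rfl fun j _ => ?_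
    rw [show m + 1 - 1 - (j + 1) = m - 1 - j by omega]
    ring

/-- Choosing an element of a finite set `O`, weighted by the numbers of smaller and larger
elements, is counted by the `(p,q)`-integer of the cardinality of `O`. -/
lemma sum_pow_card_lt_mul_pow_card_gt (p q : R) (O : Finset ℕ) :
    ∑ i ∈ O, p ^ #{j ∈ O | j < i} * q ^ #{j ∈ O | i < j} = pqInt p q #O := by
  induction O using Finset.induction_on_max with
  | empty => simp [pqInt]
  | insert a s hs ih =>
    have ha : a ∉ s := fun h => lt_irrefl _ (hs a h)
    rw [sum_insert ha, card_insert_of_notMem ha, pqInt_succ, ← ih, mul_sum]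
    congr 1
    · have h₁ : {j ∈ insert a s | j < a} = s := by
        ext j
        simp only [mem_filter, mem_insert]
        exact ⟨by rintro ⟨rfl | h, h'⟩ <;> [omega; exact h], fun h => ⟨.inr h, hs j h⟩⟩
      have h₂ : {j ∈ insert a s | a < j} = ∅ := by
        ext j
        simp only [mem_filter, mem_insert, notMem_empty, iff_false]
        rintro ⟨rfl | h, h'⟩
        · omega
        · have := hs j h
          omega
      rw [h₁, h₂]
      simp
    · refine sum_congr rfl fun i hi => ?_
      have hia := hs i hi
      have h₁ : {j ∈ insert a s | j < i} = {j ∈ s | j < i} := by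
        rw [filter_insert, if_neg (by omega)]
      have h₂ : #{j ∈ insert a s | i < j} = #{j ∈ s | i < j} + 1 := by
        rw [filter_insert, if_pos hia, card_insert_of_notMem (by simp [ha])]
      rw [h₁, h₂]
      ring

/-- The placements of non-attacking rooks on the board with rows `range r` and columns
`range c`, i.e. the graphs of partial injections. -/
def placements (r c : ℕ) : Finset (Finset (ℕ × ℕ)) :=
  {A ∈ (range r ×ˢ range c).powerset |
    (∀ x ∈ A, ∀ y ∈ A, x.1 = y.1 → x = y) ∧ (∀ x ∈ A, ∀ y ∈ A, x.2 = y.2 → x = y)}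

/-- The rows among the first `r` which contain no rook of `A`. -/
def freeRows (A : Finset (ℕ × ℕ)) (r : ℕ) : Finset ℕ := {i ∈ range r | ∀ x ∈ A, x.1 ≠ i}

/-- The columns among the first `c` which contain no rook of `A`. -/
def freeCols (A : Finset (ℕ × ℕ)) (c : ℕ) : Finset ℕ := {j ∈ range c | ∀ x ∈ A, x.2 ≠ j}

lemma mem_placements {r c : ℕ} {A : Finset (ℕ × ℕ)} :
    A ∈ placements r c ↔ (∀ x ∈ A, x.1 < r ∧ x.2 < c) ∧
      (∀ x ∈ A, ∀ y ∈ A, x.1 = y.1 → x = y) ∧ (∀ x ∈ A, ∀ y ∈ A, x.2 = y.2 → x = y) := by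
  simp [placements, subset_iff]

lemma card_freeRows {r c : ℕ} {A : Finset (ℕ × ℕ)} (hA : A ∈ placements r c) :
    #(freeRows A r) + #A = r := by
  obtain ⟨h₀, h₁, -⟩ := mem_placements.1 hA
  have h : freeRows A r = range r \ A.image Prod.fst := by
    ext i
    simp [freeRows]
    grind
  have hsub : A.image Prod.fst ⊆ range r := by
    intro i hi
    simp at hi
    obtain ⟨j, hj⟩ := hi
    simpa using (h₀ _ hj).1
  have hcard : #(A.image Prod.fst) = #A := card_image_of_injOn fun x hx y hy => h₁ x hx y hy
  have := card_sdiff_add_card_eq_card hsub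
  rw [← h, hcard, card_range] at this
  exact this

lemma card_freeCols {r c : ℕ} {A : Finset (ℕ × ℕ)} (hA : A ∈ placements r c) :
    #(freeCols A c) + #A = c := by
  obtain ⟨h₀, -, h₁⟩ := mem_placements.1 hA
  have h : freeCols A c = range c \ A.image Prod.snd := by
    ext i
    simp [freeCols]
    grind
  have hsub : A.image Prod.snd ⊆ range c := by
    intro i hi
    simp at hi
    obtain ⟨j, hj⟩ := hi
    simpa using (h₀ _ hj).2
  have hcard : #(A.image Prod.snd) = #A := card_image_of_injOn fun x hx y hy => h₁ x hx y hy
  have := card_sdiff_add_card_eq_card hsub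
  rw [← h, hcard, card_range] at this
  exact this

lemma sum_placements_succ_rows (r c : ℕ) (φ : Finset (ℕ × ℕ) → R) :
    ∑ A ∈ placements (r + 1) c, φ A =
      ∑ A ∈ placements r c, (φ A + ∑ j ∈ freeCols A c, φ (insert (r, j) A)) := by
  rw [sum_add_distrib, ← sum_filter_add_sum_filter_not (placements (r + 1) c)
    (fun A => ∀ x ∈ A, x.1 ≠ r)]
  congr 1
  · refine sum_congr ?_ fun _ _ => rfl
    ext A
    simp only [mem_filter, mem_placements]
    grind
  · rw [sum_sigma']
    symm
    refine sum_bij (fun x _ => insert (r, x.2) x.1) ?_ ?_ ?_ fun _ _ => rfl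
    · rintro ⟨A, j⟩ h
      simp only [mem_sigma, mem_filter, mem_placements, freeCols, mem_range] at h ⊢
      refine ⟨?_, fun h' => h' _ (mem_insert_self _ _) rfl⟩
      grind
    · rintro ⟨A, j⟩ h ⟨B, k⟩ h' heq
      simp only [mem_sigma, mem_filter, mem_placements, freeCols, mem_range] at h h' heq
      have hA : (r, j) ∉ A := fun hm => by have := h.1.1 _ hm; simp at this
      have hB : (r, k) ∉ B := fun hm => by have := h'.1.1 _ hm; simp at this
      have hjk : j = k := by
        have : (r, j) ∈ insert (r, k) B := heq ▸ mem_insert_self _ _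
        have hB' : (r, j) ∉ B := fun hm => by have := h'.1.1 _ hm; simp at this
        simpa [hB'] using this
      subst hjk
      have : A = B := by rw [← erase_insert hA, heq, erase_insert hB]
      rw [this]
    · intro B hB
      simp only [mem_filter, mem_placements, not_forall, not_not] at hB
      obtain ⟨⟨h₀, h₁, h₂⟩, ⟨i, j⟩, hx, hi⟩ := hB
      simp only at hi
      subst hi
      refine ⟨⟨B.erase (i, j), j⟩, ?_, insert_erase hx⟩
      simp only [mem_sigma, mem_filter, mem_placements, freeCols, mem_range]
      grind

lemma sum_placements_swap (r c : ℕ) (φ : Finset (ℕ × ℕ) → R) :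
    ∑ A ∈ placements r c, φ A = ∑ A ∈ placements c r, φ (A.image Prod.swap) := by
  have hmem : ∀ r c A, A ∈ placements r c → A.image Prod.swap ∈ placements c r := by
    intro r c A hA
    simp only [mem_placements, mem_image, forall_exists_index, and_imp] at hA ⊢
    grind
  refine sum_nbij' (image Prod.swap) (image Prod.swap) (hmem r c) (hmem c r) ?_ ?_ ?_ <;>
    simp [image_image]

lemma sum_placements_succ_cols (r c : ℕ) (φ : Finset (ℕ × ℕ) → R) :
    ∑ A ∈ placements r (c + 1), φ A =
      ∑ A ∈ placements r c, (φ A + ∑ i ∈ freeRows A r, φ (insert (i, c) A)) := by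
  rw [sum_placements_swap, sum_placements_succ_rows, sum_placements_swap r c]
  refine sum_congr rfl fun A _ => ?_
  have : freeRows (A.image Prod.swap) r = freeCols A r := by
    ext i
    simp only [freeRows, freeCols, mem_filter, mem_image, forall_exists_index, and_imp]
    grind
  rw [this]
  simp [image_insert]

/-- Row `i` contains no rook of `A` in a column `≤ k`. -/
def RowOpen (A : Finset (ℕ × ℕ)) (k i : ℕ) : Prop := ∀ c ≤ k, (i, c) ∉ A

/-- Column `j` contains no rook of `A` in a row `≤ k`. -/
def ColOpen (A : Finset (ℕ × ℕ)) (k j : ℕ) : Prop := ∀ i ≤ k, (i, j) ∉ A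

/-- The number of arcs which will nest over the arc `x`. -/
def arcNest (A : Finset (ℕ × ℕ)) (x : ℕ × ℕ) : ℕ :=
  if x.1 ≤ x.2 then #{i ∈ range x.1 | RowOpen A x.2 i} else #{j ∈ range x.2 | ColOpen A x.1 j}

/-- The number of arcs which will cross the arc `x` from the right. -/
def arcCros (A : Finset (ℕ × ℕ)) (x : ℕ × ℕ) : ℕ :=
  if x.1 ≤ x.2 then #{i ∈ Ioc x.1 x.2 | RowOpen A x.2 i}
  else #{j ∈ Ioo x.2 x.1 | ColOpen A x.1 j}

/-- The weight of the vertex `x` according to its cyclic type. The coordinates of `a` are the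
values of the variables `p, q, t, u, v, w, y`. -/
def vertexWeight (a : Fin 7 → R) (A : Finset (ℕ × ℕ)) (x : ℕ) : R :=
  if (x, x) ∈ A then a 6
  else if RowOpen A x x then (if ColOpen A x x then a 5 else a 3)
  else a 2 * (if ColOpen A x x then a 4 else 1)

/-- The weight of a placement on the `n × n` board. -/
def weight (a : Fin 7 → R) (n : ℕ) (A : Finset (ℕ × ℕ)) : R :=
  (∏ x ∈ A, a 0 ^ arcNest A x * a 1 ^ arcCros A x) * ∏ x ∈ range n, vertexWeight a A x

lemma rowOpen_congr {n i k : ℕ} {A B : Finset (ℕ × ℕ)}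
    (h : ∀ i < n, ∀ j < n, ((i, j) ∈ A ↔ (i, j) ∈ B)) (hi : i < n) (hk : k < n) :
    RowOpen A k i ↔ RowOpen B k i :=
  forall₂_congr fun c hc => not_congr (h i hi c (hc.trans_lt hk))

lemma colOpen_congr {n j k : ℕ} {A B : Finset (ℕ × ℕ)}
    (h : ∀ i < n, ∀ j < n, ((i, j) ∈ A ↔ (i, j) ∈ B)) (hj : j < n) (hk : k < n) :
    ColOpen A k j ↔ ColOpen B k j :=
  forall₂_congr fun c hc => not_congr (h c (hc.trans_lt hk) j hj)

lemma arcNest_congr {n : ℕ} {A B : Finset (ℕ × ℕ)} {x : ℕ × ℕ}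
    (h : ∀ i < n, ∀ j < n, ((i, j) ∈ A ↔ (i, j) ∈ B)) (hx : x.1 < n ∧ x.2 < n) :
    arcNest A x = arcNest B x := by
  unfold arcNest
  congr 2
  · refine filter_congr fun i hi => rowOpen_congr h ?_ hx.2
    grind
  · refine filter_congr fun i hi => colOpen_congr h ?_ hx.1
    grind

lemma arcCros_congr {n : ℕ} {A B : Finset (ℕ × ℕ)} {x : ℕ × ℕ}
    (h : ∀ i < n, ∀ j < n, ((i, j) ∈ A ↔ (i, j) ∈ B)) (hx : x.1 < n ∧ x.2 < n) :
    arcCros A x = arcCros B x := by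
  unfold arcCros
  congr 2
  · refine filter_congr fun i hi => rowOpen_congr h ?_ hx.2
    grind
  · refine filter_congr fun i hi => colOpen_congr h ?_ hx.1
    grind

lemma vertexWeight_congr {n x : ℕ} {A B : Finset (ℕ × ℕ)} (a : Fin 7 → R)
    (h : ∀ i < n, ∀ j < n, ((i, j) ∈ A ↔ (i, j) ∈ B)) (hx : x < n) :
    vertexWeight a A x = vertexWeight a B x := by
  simp only [vertexWeight, h x hx x hx, rowOpen_congr h hx hx, colOpen_congr h hx hx]

lemma weight_succ (a : Fin 7 → R) {n : ℕ} {A E : Finset (ℕ × ℕ)}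
    (hA : ∀ x ∈ A, x.1 < n ∧ x.2 < n) (hE : ∀ x ∈ E, x.1 = n ∨ x.2 = n) :
    weight a (n + 1) (E ∪ A) = weight a n A *
      ((∏ x ∈ E, a 0 ^ arcNest (E ∪ A) x * a 1 ^ arcCros (E ∪ A) x) *
        vertexWeight a (E ∪ A) n) := by
  have h : ∀ i < n, ∀ j < n, ((i, j) ∈ E ∪ A ↔ (i, j) ∈ A) := by
    intro i hi j hj
    have := hE (i, j)
    grind
  have hd : Disjoint E A := disjoint_left.2 fun x hx hx' => by
    have := hA x hx'
    have := hE x hx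
    omega
  unfold weight
  rw [prod_union hd, prod_range_succ,
    prod_congr (s₁ := A) rfl fun x hx => by
      rw [arcNest_congr h (hA x hx), arcCros_congr h (hA x hx)],
    prod_congr (s₁ := range n) rfl fun x hx => vertexWeight_congr a h (mem_range.1 hx)]
  ring

/-- The operator adding one vertex to a placement, acting on functions of the number of free
rows. -/
def transfer (a : Fin 7 → R) (g : ℕ → R) (h : ℕ) : R :=
  a 5 * g (h + 1) +
    (a 6 * a 0 ^ h + (a 1 * a 3 + a 2 * a 4) * pqInt (a 0) (a 1) h) * g h +
    a 2 * pqInt (a 0) (a 1) h ^ 2 * g (h - 1)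

lemma weight_extend_valley {n : ℕ} {A : Finset (ℕ × ℕ)} (a : Fin 7 → R)
    (hA : A ∈ placements n n) :
    weight a (n + 1) A = weight a n A * a 5 := by
  have hA₀ := (mem_placements.1 hA).1
  have h := weight_succ a (E := ∅) hA₀ (by simp)
  simp only [empty_union, prod_empty, one_mul] at h
  rw [h]
  congr 1
  have h₁ : (n, n) ∉ A := by grind
  have h₂ : RowOpen A n n := by grind [RowOpen]
  have h₃ : ColOpen A n n := by grind [ColOpen]
  simp [vertexWeight, h₁, h₂, h₃]

lemma weight_extend_fixed {n : ℕ} {A : Finset (ℕ × ℕ)} (a : Fin 7 → R)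
    (hA : A ∈ placements n n) :
    weight a (n + 1) (insert (n, n) A) = weight a n A * (a 6 * a 0 ^ #(freeRows A n)) := by
  have hA₀ := (mem_placements.1 hA).1
  have h := weight_succ a (E := {(n, n)}) hA₀ (by simp)
  rw [singleton_union, prod_singleton] at h
  rw [h]
  have h₁ : arcNest (insert (n, n) A) (n, n) = #(freeRows A n) := by
    simp only [arcNest, le_refl, if_true]
    congr 1
    ext i
    simp only [RowOpen, freeRows, mem_filter, mem_range, mem_insert]
    grind
  have h₂ : arcCros (insert (n, n) A) (n, n) = 0 := by simp [arcCros]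
  simp [vertexWeight, h₁, h₂]
  ring

lemma weight_extend_doubleExcedance {n : ℕ} {A : Finset (ℕ × ℕ)} (a : Fin 7 → R)
    (hA : A ∈ placements n n) {i : ℕ} (hi : i ∈ freeRows A n) :
    weight a (n + 1) (insert (i, n) A) = weight a n A *
      (a 1 * a 3 *
        (a 0 ^ #{j ∈ freeRows A n | j < i} * a 1 ^ #{j ∈ freeRows A n | i < j})) := by
  have hA₀ := (mem_placements.1 hA).1
  have h := weight_succ a (E := {(i, n)}) hA₀ (by simp)
  rw [singleton_union, prod_singleton] at h
  rw [h]
  have hi' : i < n ∧ ∀ x ∈ A, x.1 ≠ i := by simpa [freeRows] using hi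
  have h₁ : arcNest (insert (i, n) A) (i, n) = #{j ∈ freeRows A n | j < i} := by
    simp only [arcNest, hi'.1.le, if_true]
    congr 1
    ext j
    simp only [RowOpen, freeRows, mem_filter, mem_range, mem_insert]
    grind
  have h₂ : arcCros (insert (i, n) A) (i, n) = #{j ∈ freeRows A n | i < j} + 1 := by
    simp only [arcCros, hi'.1.le, if_true]
    rw [← card_insert_of_notMem (a := n) (by simp [freeRows])]
    congr 1
    ext j
    simp only [RowOpen, freeRows, mem_filter, mem_range, mem_insert, mem_Ioc]
    grind
  have h₃ : (n, n) ∉ insert (i, n) A := by grind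
  have h₄ : RowOpen (insert (i, n) A) n n := by grind [RowOpen]
  have h₅ : ¬ ColOpen (insert (i, n) A) n n := by grind [ColOpen]
  simp only [vertexWeight, h₁, h₂, h₃, h₄, h₅, if_true, if_false]
  ring

lemma arc_extend_drop {n : ℕ} {A : Finset (ℕ × ℕ)} (hA : A ∈ placements n n)
    {i : ℕ} {E : Finset (ℕ × ℕ)} (hi : i ∈ freeCols A n)
    (hE : ∀ x ∈ E, x.2 = n) :
    arcNest (insert (n, i) (E ∪ A)) (n, i) = #{j ∈ freeCols A n | j < i} ∧
      arcCros (insert (n, i) (E ∪ A)) (n, i) = #{j ∈ freeCols A n | i < j} := by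
  have hA₀ := (mem_placements.1 hA).1
  have hi' : i < n ∧ ∀ x ∈ A, x.2 ≠ i := by simpa [freeCols] using hi
  simp only [arcNest, arcCros, hi'.1.not_ge, if_false]
  constructor
  all_goals
    congr 1
    ext j
    simp only [ColOpen, freeCols, mem_filter, mem_range, mem_insert, mem_Ioo, mem_union]
    grind

lemma weight_extend_doubleDrop {n : ℕ} {A : Finset (ℕ × ℕ)} (a : Fin 7 → R)
    (hA : A ∈ placements n n) {j : ℕ} (hj : j ∈ freeCols A n) :
    weight a (n + 1) (insert (n, j) A) = weight a n A *
      (a 2 * a 4 *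
        (a 0 ^ #{i ∈ freeCols A n | i < j} * a 1 ^ #{i ∈ freeCols A n | j < i})) := by
  have hA₀ := (mem_placements.1 hA).1
  have h := weight_succ a (E := {(n, j)}) hA₀ (by simp)
  rw [singleton_union, prod_singleton] at h
  rw [h]
  have hj' : j < n ∧ ∀ x ∈ A, x.2 ≠ j := by simpa [freeCols] using hj
  obtain ⟨h₁, h₂⟩ := arc_extend_drop hA (E := ∅) hj (by simp)
  rw [empty_union] at h₁ h₂
  have h₃ : (n, n) ∉ insert (n, j) A := by grind
  have h₄ : ¬ RowOpen (insert (n, j) A) n n := by grind [RowOpen]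
  have h₅ : ColOpen (insert (n, j) A) n n := by grind [ColOpen]
  simp only [vertexWeight, h₁, h₂, h₃, h₄, h₅, if_true, if_false]
  ring

lemma weight_extend_peak {n : ℕ} {A : Finset (ℕ × ℕ)} (a : Fin 7 → R)
    (hA : A ∈ placements n n) {i j : ℕ} (hi : i ∈ freeRows A n) (hj : j ∈ freeCols A n) :
    weight a (n + 1) (insert (i, n) (insert (n, j) A)) = weight a n A *
      (a 2 * (a 0 ^ #{k ∈ freeRows A n | k < i} * a 1 ^ #{k ∈ freeRows A n | i < k}) *
        (a 0 ^ #{k ∈ freeCols A n | k < j} * a 1 ^ #{k ∈ freeCols A n | j < k})) := by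
  have hA₀ := (mem_placements.1 hA).1
  have hi' : i < n ∧ ∀ x ∈ A, x.1 ≠ i := by simpa [freeRows] using hi
  have hj' : j < n ∧ ∀ x ∈ A, x.2 ≠ j := by simpa [freeCols] using hj
  have hne : (i, n) ≠ (n, j) := by simp [hi'.1.ne]
  have h := weight_succ a (E := {(i, n), (n, j)}) hA₀ (by simp)
  rw [prod_pair hne, insert_union, singleton_union] at h
  rw [h]
  obtain ⟨h₁, h₂⟩ := arc_extend_drop hA (E := {(i, n)}) hj (by simp)
  rw [singleton_union, insert_comm] at h₁ h₂
  have h₁' : arcNest (insert (i, n) (insert (n, j) A)) (i, n) = #{k ∈ freeRows A n | k < i} := by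
    simp only [arcNest, hi'.1.le, if_true]
    congr 1
    ext k
    simp only [RowOpen, freeRows, mem_filter, mem_range, mem_insert]
    grind
  have h₂' : arcCros (insert (i, n) (insert (n, j) A)) (i, n) = #{k ∈ freeRows A n | i < k} := by
    simp only [arcCros, hi'.1.le, if_true]
    congr 1
    ext k
    simp only [RowOpen, freeRows, mem_filter, mem_range, mem_insert, mem_Ioc]
    grind
  have h₃ : (n, n) ∉ insert (i, n) (insert (n, j) A) := by grind
  have h₄ : ¬ RowOpen (insert (i, n) (insert (n, j) A)) n n := by grind [RowOpen]
  have h₅ : ¬ ColOpen (insert (i, n) (insert (n, j) A)) n n := by grind [ColOpen]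
  simp only [vertexWeight, h₁, h₂, h₁', h₂', h₃, h₄, h₅, if_false]
  ring

lemma sum_placements_weight_succ (a : Fin 7 → R) (g : ℕ → R) (n : ℕ) :
    ∑ B ∈ placements (n + 1) (n + 1), weight a (n + 1) B * g (n + 1 - #B) =
      ∑ A ∈ placements n n, weight a n A * transfer a g (n - #A) := by
  rw [sum_placements_succ_cols, sum_placements_succ_rows]
  refine sum_congr rfl fun A hA => ?_
  have hA₀ := (mem_placements.1 hA).1
  have hr := card_freeRows hA
  have hc := card_freeCols hA
  have h₁ : freeRows A (n + 1) = insert n (freeRows A n) := by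
    ext i
    simp only [freeRows, mem_filter, mem_range, mem_insert]
    grind
  have h₂ : ∀ j, freeRows (insert (n, j) A) (n + 1) = freeRows A n := by
    intro j
    ext i
    simp only [freeRows, mem_filter, mem_range, forall_mem_insert]
    grind
  have hn : n ∉ freeRows A n := by simp [freeRows]
  have hcr : ∀ i ∈ insert n (freeRows A n), #(insert (i, n) A) = #A + 1 := fun i _ =>
    card_insert_of_notMem fun h => by have := hA₀ _ h; simp at this
  have hcc : ∀ j, #(insert (n, j) A) = #A + 1 := fun j =>
    card_insert_of_notMem fun h => by have := hA₀ _ h; simp at this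
  have hcrc : ∀ i ∈ freeRows A n, ∀ j, #(insert (i, n) (insert (n, j) A)) = #A + 2 := by
    intro i hi j
    rw [card_insert_of_notMem, hcc]
    have : i ≠ n := fun h => hn (h ▸ hi)
    grind
  have hsr := sum_pow_card_lt_mul_pow_card_gt (a 0) (a 1) (freeRows A n)
  have hsc := sum_pow_card_lt_mul_pow_card_gt (a 0) (a 1) (freeCols A n)
  have e₁ : ∑ i ∈ freeRows A n, weight a (n + 1) (insert (i, n) A) *
        g (n + 1 - #(insert (i, n) A)) =
      weight a n A * (a 1 * a 3 * pqInt (a 0) (a 1) #(freeRows A n) * g (n - #A)) := by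
    rw [← hsr, mul_sum, sum_mul, mul_sum]
    refine sum_congr rfl fun i hi => ?_
    rw [weight_extend_doubleExcedance a hA hi, hcr i (mem_insert_of_mem hi),
      Nat.add_sub_add_right]
    ring
  have e₂ : ∑ j ∈ freeCols A n, weight a (n + 1) (insert (n, j) A) *
        g (n + 1 - #(insert (n, j) A)) =
      weight a n A * (a 2 * a 4 * pqInt (a 0) (a 1) #(freeCols A n) * g (n - #A)) := by
    rw [← hsc, mul_sum, sum_mul, mul_sum]
    refine sum_congr rfl fun i hi => ?_
    rw [weight_extend_doubleDrop a hA hi, hcc, Nat.add_sub_add_right]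
    ring
  have e₃ : ∑ j ∈ freeCols A n, ∑ i ∈ freeRows A n,
        weight a (n + 1) (insert (i, n) (insert (n, j) A)) *
          g (n + 1 - #(insert (i, n) (insert (n, j) A))) =
      weight a n A * (a 2 * pqInt (a 0) (a 1) #(freeRows A n) *
        pqInt (a 0) (a 1) #(freeCols A n) * g (n - #A - 1)) := by
    rw [← hsc, mul_sum, sum_mul, mul_sum]
    refine sum_congr rfl fun j hj => ?_
    rw [← hsr, mul_sum, sum_mul, sum_mul, mul_sum]
    refine sum_congr rfl fun i hi => ?_
    rw [weight_extend_peak a hA hi hj, hcrc i hi, show n + 1 - (#A + 2) = n - #A - 1 by omega]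
    ring
  simp only [h₁, h₂, sum_insert hn, sum_add_distrib]
  rw [e₁, e₂, e₃, weight_extend_valley a hA, weight_extend_fixed a hA,
    hcr n (mem_insert_self _ _), Nat.add_sub_add_right,
    show n + 1 - #A = n - #A + 1 by omega, show #(freeRows A n) = n - #A by omega,
    show #(freeCols A n) = n - #A by omega]
  unfold transfer
  ring

lemma sum_placements_weight (a : Fin 7 → R) (n : ℕ) (g : ℕ → R) :
    ∑ A ∈ placements n n, weight a n A * g (n - #A) = (transfer a)^[n] g 0 := by
  induction n generalizing g with
  | zero =>
    have : placements 0 0 = {∅} := by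
      ext A
      simp [mem_placements]
      grind
    simp [this, weight]
  | succ n ih => rw [sum_placements_weight_succ, ih, Function.iterate_succ_apply]

/-- The weight of a step `s` starting at height `h`. -/
def stepWeight (a : Fin 7 → R) (s : Fin 3) (h : ℕ) : R :=
  if s = 0 then a 2 * a 5 * pqInt (a 0) (a 1) (h + 1)
  else if s = 1 then a 6 * a 0 ^ h + (a 1 * a 3 + a 2 * a 4) * pqInt (a 0) (a 1) h
  else pqInt (a 0) (a 1) h

/-- The weighted sum over the paths with `n` steps from height `h` to height `0` which never
go below the x-axis. -/
def pathSum (a : Fin 7 → R) (n : ℕ) (h : ℤ) : R :=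
  ∑ γ : Fin n → Fin 3, if (∀ i ≤ n, 0 ≤ h + hgt n γ i) ∧ h + hgt n γ n = 0 then
    ∏ i : Fin n, stepWeight a (γ i) (h + hgt n γ i).toNat else 0

lemma hgt_zero (n : ℕ) (γ : Fin n → Fin 3) : hgt n γ 0 = 0 := by simp [hgt]

lemma hgt_cons_succ (n : ℕ) (s : Fin 3) (γ : Fin n → Fin 3) (i : ℕ) :
    hgt (n + 1) (Fin.cons s γ : Fin (n + 1) → Fin 3) (i + 1) = 1 - ((s : ℕ) : ℤ) + hgt n γ i := by
  unfold hgt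
  rw [sum_range_succ', add_comm]
  congr 1
  refine sum_congr rfl fun j _ => ?_
  by_cases hj : j < n
  · rw [dif_pos hj, dif_pos (by omega)]
    rfl
  · rw [dif_neg hj, dif_neg (by omega)]

lemma pathSum_succ (a : Fin 7 → R) (n : ℕ) {h : ℤ} (hh : 0 ≤ h) :
    pathSum a (n + 1) h =
      ∑ s : Fin 3, stepWeight a s h.toNat * pathSum a n (h + (1 - ((s : ℕ) : ℤ))) := by
  unfold pathSum
  rw [← (Fin.consEquiv fun _ => Fin 3).sum_comp, Fintype.sum_prod_type]
  refine sum_congr rfl fun s _ => ?_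
  rw [mul_sum]
  refine sum_congr rfl fun γ _ => ?_
  have hc : Fin.consEquiv (fun _ => Fin 3) (s, γ) = (Fin.cons s γ : Fin (n + 1) → Fin 3) := rfl
  rw [hc, mul_ite, mul_zero]
  refine if_congr (and_congr ⟨fun H i hi => ?_, fun H i hi => ?_⟩ ?_) ?_ rfl
  · have := H (i + 1) (by omega)
    rw [hgt_cons_succ] at this
    omega
  · cases i with
    | zero => simpa [hgt_zero] using hh
    | succ i =>
      have := H i (by omega)
      rw [hgt_cons_succ]
      omega
  · rw [hgt_cons_succ, ← add_assoc]
  · simp [Fin.prod_univ_succ, hgt_zero, hgt_cons_succ, add_assoc]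

lemma pathSum_eq_transfer (a : Fin 7 → R) (n h : ℕ) :
    a 2 ^ h * (∏ k ∈ range h, pqInt (a 0) (a 1) (k + 1)) * pathSum a n h =
      (transfer a)^[n] (Pi.single 0 1) h := by
  induction n generalizing h with
  | zero =>
    rcases h with - | h
    · simp [pathSum, hgt_zero]
    · have : ((h : ℤ) + 1) ≠ 0 := by omega
      simp [pathSum, hgt_zero, this]
  | succ n ih =>
    rw [Function.iterate_succ_apply', transfer, ← ih, ← ih, ← ih,
      pathSum_succ a n (Int.natCast_nonneg h), Fin.sum_univ_three, prod_range_succ]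
    rcases h with - | h
    · simp [stepWeight, pqInt]
      ring
    · simp [stepWeight, prod_range_succ]
      ring_nf

lemma sum_motzkin (a : Fin 7 → R) (n : ℕ) :
    ∑ γ ∈ motzkin n, ∏ i : Fin n, stepWeight a (γ i) (hgt n γ i).toNat = pathSum a n 0 := by
  rw [motzkin, sum_filter, pathSum]
  refine sum_congr rfl fun γ _ => ?_
  simp only [zero_add]
  congr 1

/-- The graph of a permutation, as a rook placement. -/
def permGraph {n : ℕ} (σ : Equiv.Perm (Fin n)) : Finset (ℕ × ℕ) :=
  univ.image fun i : Fin n => ((i : ℕ), (σ i : ℕ))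

lemma mem_permGraph {n : ℕ} {σ : Equiv.Perm (Fin n)} {i j : Fin n} :
    ((i : ℕ), (j : ℕ)) ∈ permGraph σ ↔ σ i = j := by
  simp [permGraph, Fin.val_inj]

lemma permGraph_injective (n : ℕ) :
    Function.Injective (permGraph : Equiv.Perm (Fin n) → Finset (ℕ × ℕ)) := by
  intro σ τ h
  ext i
  have : ((i : ℕ), (σ i : ℕ)) ∈ permGraph τ := h ▸ mem_permGraph.2 rfl
  rw [mem_permGraph.1 this]

lemma card_permGraph {n : ℕ} (σ : Equiv.Perm (Fin n)) : #(permGraph σ) = n := by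
  rw [permGraph, card_image_of_injective, card_univ, Fintype.card_fin]
  intro i j h
  exact Fin.ext (Prod.ext_iff.1 h).1

lemma permGraph_mem_placements {n : ℕ} (σ : Equiv.Perm (Fin n)) :
    permGraph σ ∈ placements n n := by
  simp only [mem_placements, permGraph, mem_image, mem_univ, true_and, forall_exists_index,
    forall_apply_eq_imp_iff]
  refine ⟨fun i => ⟨i.2, (σ i).2⟩, fun i j h => ?_, fun i j h => ?_⟩
  · rw [Fin.ext h]
  · rw [σ.injective (Fin.ext h)]

lemma exists_permGraph_eq {n : ℕ} {A : Finset (ℕ × ℕ)} (hA : A ∈ placements n n) (hc : #A = n) :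
    ∃ σ : Equiv.Perm (Fin n), permGraph σ = A := by
  obtain ⟨h₀, -, h₂⟩ := mem_placements.1 hA
  have hfree : freeRows A n = ∅ := by
    have := card_freeRows hA
    rw [← card_eq_zero]
    omega
  have hex : ∀ i : Fin n, ∃ j : Fin n, ((i : ℕ), (j : ℕ)) ∈ A := by
    intro i
    have : (i : ℕ) ∉ freeRows A n := by simp [hfree]
    simp only [freeRows, mem_filter, mem_range, i.2, true_and, not_forall, not_not] at this
    obtain ⟨⟨k, j⟩, hx, hk⟩ := this
    simp only at hk
    exact ⟨⟨j, (h₀ _ hx).2⟩, hk ▸ hx⟩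
  choose f hf using hex
  have hinj : Function.Injective f := by
    intro i j h
    have := h₂ _ (hf i) _ (hf j) (by rw [h])
    exact Fin.ext (Prod.ext_iff.1 this).1
  refine ⟨Equiv.ofBijective f (Finite.injective_iff_bijective.1 hinj), ?_⟩
  refine eq_of_subset_of_card_le ?_ (by rw [card_permGraph, hc])
  intro x hx
  simp only [permGraph, mem_image, mem_univ, true_and, Equiv.ofBijective_apply] at hx
  obtain ⟨i, rfl⟩ := hx
  exact hf i

lemma sum_perm_weight (a : Fin 7 → R) (n : ℕ) :
    ∑ σ : Equiv.Perm (Fin n), weight a n (permGraph σ) =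
      ∑ A ∈ placements n n, weight a n A * (Pi.single 0 1 : ℕ → R) (n - #A) := by
  rw [← sum_image (f := weight a n) (g := permGraph) (s := univ)
    (permGraph_injective n).injOn]
  refine sum_subset_zero_on_sdiff ?_ ?_ ?_
  · intro A hA
    obtain ⟨σ, -, rfl⟩ := mem_image.1 hA
    exact permGraph_mem_placements σ
  · intro A hA
    obtain ⟨hA, hA'⟩ := mem_sdiff.1 hA
    have : n - #A ≠ 0 := by
      intro h0
      have := card_freeRows hA
      obtain ⟨σ, hσ⟩ := exists_permGraph_eq hA (by omega)
      exact hA' (mem_image.2 ⟨σ, mem_univ _, hσ⟩)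
    simp [this]
  · intro A hA
    obtain ⟨σ, -, rfl⟩ := mem_image.1 hA
    simp [card_permGraph]

lemma sum_perm_weight_eq_sum_motzkin (a : Fin 7 → R) (n : ℕ) :
    ∑ σ : Equiv.Perm (Fin n), weight a n (permGraph σ) =
      ∑ γ ∈ motzkin n, ∏ i : Fin n, stepWeight a (γ i) (hgt n γ i).toNat := by
  rw [sum_perm_weight, sum_placements_weight, ← pathSum_eq_transfer, sum_motzkin]
  simp

lemma rowOpen_permGraph {n : ℕ} {σ : Equiv.Perm (Fin n)} {k : ℕ} {i : Fin n} :
    RowOpen (permGraph σ) k i ↔ k < σ i := by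
  refine ⟨fun h => ?_, fun h c hc hm => ?_⟩
  · by_contra! hk
    exact h _ hk (mem_permGraph.2 rfl)
  · have : σ i = ⟨c, ((mem_placements.1 (permGraph_mem_placements σ)).1 _ hm).2⟩ :=
      mem_permGraph.1 hm
    rw [this] at h
    simp only at h
    omega

lemma colOpen_permGraph {n : ℕ} {σ : Equiv.Perm (Fin n)} {k : ℕ} {i : Fin n} :
    ColOpen (permGraph σ) k (σ i) ↔ k < i := by
  refine ⟨fun h => ?_, fun h c hc hm => ?_⟩
  · by_contra! hk
    exact h _ hk (mem_permGraph.2 rfl)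
  · have : σ ⟨c, ((mem_placements.1 (permGraph_mem_placements σ)).1 _ hm).1⟩ = σ i :=
      mem_permGraph.1 hm
    have := congrArg Fin.val (σ.injective this)
    simp only at this
    omega

lemma pext_succ {n : ℕ} (σ : Equiv.Perm (Fin n)) (i : Fin n) :
    pext n σ ((i : ℕ) + 1) = (σ i : ℕ) + 1 := by
  simp [pext]

lemma card_eq_sum_fin {n : ℕ} {S : Finset ℕ} (hS : ∀ k ∈ S, k < n) :
    #S = ∑ i : Fin n, if (i : ℕ) ∈ S then 1 else 0 := by
  rw [Fin.sum_univ_eq_sum_range (fun i => if i ∈ S then 1 else 0) n, sum_ite_mem, sum_const,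
    smul_eq_mul, mul_one, inter_eq_right.2 fun k hk => mem_range.2 (hS k hk)]

lemma sum_Icc_one_eq_sum_fin (n : ℕ) (f : ℕ → ℕ) :
    ∑ i ∈ Icc 1 n, f i = ∑ i : Fin n, f ((i : ℕ) + 1) := by
  rw [Fin.sum_univ_eq_sum_range (fun i => f (i + 1)) n, range_eq_Ico, sum_Ico_add' f 0 n 1]
  rfl

lemma card_filter_Icc_one (n : ℕ) (P : ℕ → Prop) [DecidablePred P] :
    #{i ∈ Icc 1 n | P i} = ∑ i : Fin n, if P ((i : ℕ) + 1) then 1 else 0 := by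
  rw [card_filter, sum_Icc_one_eq_sum_fin]

lemma card_filter_pairs (n : ℕ) (P : ℕ × ℕ → Prop) [DecidablePred P] :
    #{x ∈ pairs n | P x} =
      ∑ i : Fin n, ∑ j : Fin n, if P ((i : ℕ) + 1, (j : ℕ) + 1) then 1 else 0 := by
  rw [card_filter, pairs, sum_product, sum_Icc_one_eq_sum_fin]
  exact sum_congr rfl fun i _ => sum_Icc_one_eq_sum_fin n _

lemma arcNest_permGraph {n : ℕ} (σ : Equiv.Perm (Fin n)) (i : Fin n) :
    arcNest (permGraph σ) (i, σ i) = ∑ j : Fin n,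
      if (j < i ∧ i ≤ σ i ∧ σ i < σ j) ∨ (i < j ∧ σ i < i ∧ σ j < σ i) then 1 else 0 := by
  unfold arcNest
  have hi := (σ i).2
  split_ifs with h
  · rw [card_eq_sum_fin (n := n) (by grind)]
    refine sum_congr rfl fun j _ => if_congr ?_ rfl rfl
    rw [mem_filter, rowOpen_permGraph, mem_range]
    omega
  · rw [card_eq_sum_fin (n := n) (by grind), ← Equiv.sum_comp σ]
    refine sum_congr rfl fun j _ => if_congr ?_ rfl rfl
    rw [mem_filter, colOpen_permGraph, mem_range]
    simp only at h
    omega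

lemma arcCros_permGraph {n : ℕ} (σ : Equiv.Perm (Fin n)) (i : Fin n) :
    arcCros (permGraph σ) (i, σ i) =
      (∑ j : Fin n, if i < j ∧ j ≤ σ i ∧ σ i < σ j then 1 else 0) +
        ∑ j : Fin n, if i < j ∧ σ j < i ∧ σ i < σ j then 1 else 0 := by
  unfold arcCros
  have hi := (σ i).2
  rw [← sum_add_distrib]
  split_ifs with h
  · rw [card_eq_sum_fin (n := n) (by grind)]
    refine sum_congr rfl fun j _ => ?_
    simp only [mem_filter, rowOpen_permGraph, mem_Ioc] at h ⊢
    split_ifs <;> omega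
  · rw [card_eq_sum_fin (n := n) (by grind), ← Equiv.sum_comp σ]
    refine sum_congr rfl fun j _ => ?_
    simp only [mem_filter, colOpen_permGraph, mem_Ioo] at h ⊢
    split_ifs <;> omega

lemma nestStat_eq_sum {n : ℕ} (σ : Equiv.Perm (Fin n)) :
    nestStat n σ = ∑ i : Fin n, arcNest (permGraph σ) (i, σ i) := by
  rw [nestStat, card_filter_pairs, sum_comm]
  simp only [arcNest_permGraph, pext_succ]
  refine sum_congr rfl fun i _ => sum_congr rfl fun j _ => if_congr ?_ rfl rfl
  omega

lemma crosStat_eq_sum {n : ℕ} (σ : Equiv.Perm (Fin n)) :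
    crosStat n σ = ∑ i : Fin n, arcCros (permGraph σ) (i, σ i) := by
  rw [crosStat, card_filter_pairs]
  simp only [arcCros_permGraph, pext_succ]
  rw [sum_add_distrib,
    sum_comm (f := fun i j : Fin n => if i < j ∧ σ j < i ∧ σ i < σ j then 1 else 0),
    ← sum_add_distrib]
  refine sum_congr rfl fun i _ => ?_
  rw [← sum_add_distrib]
  refine sum_congr rfl fun j _ => ?_
  split_ifs <;> omega

lemma vertexWeight_permGraph (a : Fin 7 → R) {n : ℕ} (σ : Equiv.Perm (Fin n)) (i : Fin n) :
    vertexWeight a (permGraph σ) i =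
      a 2 ^ (if σ i < i then 1 else 0) * a 3 ^ (if σ⁻¹ i < i ∧ i < σ i then 1 else 0) *
        a 4 ^ (if i < σ⁻¹ i ∧ σ i < i then 1 else 0) *
        a 5 ^ (if i < σ⁻¹ i ∧ i < σ i then 1 else 0) * a 6 ^ (if σ i = i then 1 else 0) := by
  have hcol : ColOpen (permGraph σ) i i ↔ i < σ⁻¹ i := by
    have := colOpen_permGraph (σ := σ) (k := i) (i := σ⁻¹ i)
    rwa [show σ (σ⁻¹ i) = i from σ.apply_symm_apply i] at this
  have hinv : σ⁻¹ i = i ↔ σ i = i := by rw [Equiv.Perm.inv_eq_iff_eq, eq_comm]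
  simp only [vertexWeight, mem_permGraph, rowOpen_permGraph, hcol, Fin.val_fin_lt]
  generalize σ⁻¹ i = k at hinv ⊢
  rcases lt_trichotomy (σ i) i with h | h | h
  · simp [h, h.ne, h.not_gt]
  · simp [h, hinv.2 h]
  · have h' : k ≠ i := fun e => h.ne' (hinv.1 e)
    rcases lt_or_gt_of_ne h' with h'' | h'' <;> simp [h, h.ne', h.not_gt, h'', h''.not_gt]

lemma prod_permGraph {n : ℕ} (σ : Equiv.Perm (Fin n)) (f : ℕ × ℕ → R) :
    ∏ x ∈ permGraph σ, f x = ∏ i : Fin n, f (i, σ i) :=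
  prod_image fun _ _ _ _ h => Fin.ext (Prod.ext_iff.1 h).1

lemma weight_permGraph (a : Fin 7 → R) {n : ℕ} (σ : Equiv.Perm (Fin n)) :
    weight a n (permGraph σ) = a 0 ^ nestStat n σ * a 1 ^ crosStat n σ * a 2 ^ dropStat n σ *
      a 3 ^ cdaStat n σ * a 4 ^ cddStat n σ * a 5 ^ cvalleyStat n σ * a 6 ^ fixStat n σ := by
  have hprod : ∏ x ∈ permGraph σ, a 0 ^ arcNest (permGraph σ) x * a 1 ^ arcCros (permGraph σ) x =
      a 0 ^ nestStat n σ * a 1 ^ crosStat n σ := by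
    rw [prod_permGraph, prod_mul_distrib,
      prod_pow_eq_pow_sum, prod_pow_eq_pow_sum, nestStat_eq_sum, crosStat_eq_sum]
  rw [weight, hprod, ← Fin.prod_univ_eq_prod_range (vertexWeight a (permGraph σ))]
  simp only [vertexWeight_permGraph, prod_mul_distrib, prod_pow_eq_pow_sum, dropStat, cdaStat,
    cddStat, cvalleyStat, fixStat, card_filter_Icc_one, pext_succ, add_lt_add_iff_right,
    add_left_inj, Fin.val_fin_lt, Fin.val_inj]
  ring

end PartialPermutations

open MvPolynomial in
theorem statement19 (n : ℕ) (hn : 1 ≤ n) :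
    (∑ σ : Equiv.Perm (Fin n),
        (X 0 : MvPolynomial (Fin 7) ℤ) ^ nestStat n σ * X 1 ^ crosStat n σ *
          X 2 ^ dropStat n σ * X 3 ^ cdaStat n σ * X 4 ^ cddStat n σ *
          X 5 ^ cvalleyStat n σ * X 6 ^ fixStat n σ) =
      ∑ γ ∈ motzkin n,
        ∏ i : Fin n,
          (if γ i = 0 then
            X 2 * X 5 * pqInt (X 0 : MvPolynomial (Fin 7) ℤ) (X 1)
              ((hgt n γ (i : ℕ)).toNat + 1)
          else if γ i = 1 then
            X 6 * X 0 ^ (hgt n γ (i : ℕ)).toNat +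
              (X 1 * X 3 + X 2 * X 4) *
                pqInt (X 0 : MvPolynomial (Fin 7) ℤ) (X 1)
                  (hgt n γ (i : ℕ)).toNat
          else
            pqInt (X 0 : MvPolynomial (Fin 7) ℤ) (X 1)
              (hgt n γ (i : ℕ)).toNat) := by
  rw [← Finset.sum_congr rfl fun σ _ => weight_permGraph X σ, sum_perm_weight_eq_sum_motzkin]
  rfl

end SZpaper
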